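/- For each n, let W_n be a symmetric n×n real matrix with nonnegative entries and zero diagonal, not identically zero, with nodal strengths s^{(n)}_i = Σ_j (W_n)_{ij}, maximal nodal strength s_max(n), total strength S_n > 0, and c_n = 1/S_n. Let λ^{(n)}_1 ≥ … ≥ λ^{(n)}_n ≥ 0 be the trace-normalized Laplacian eigenvalues (summing to 1), n_+(n) the number of strictly positive eigenvalues, λ_max(n) the largest eigenvalue, λ_min(n) the smallest strictly positive eigenvalue, H_n the von Neumann graph entropy, Q_n = 1 − Σ_i (λ^{(n)}_i)², and H̃_n = −Q_n · ln(2·c_n·s_max(n)). Suppose there exist constants α > 0 and β > 0 such that for all sufficiently large n, n_+(n) ≥ α·n, λ_max(n) < 1, and λ_min(n) ≥ β·λ_max(n). Then the scaled approximation error (H_n − H̃_n)/ln n → 0 as n → ∞. -/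

import Mathlib

theorem abs_log_le_of_mem {a b t : ℝ} (ha : 0 < a) (hat : a ≤ t) (htb : t ≤ b) :
    |Real.log t| ≤ |Real.log a| + |Real.log b| := by
  have h1 := Real.log_le_log ha hat
  have h2 := Real.log_le_log (ha.trans_le hat) htb
  rw [abs_le]
  constructor <;>
  linarith [neg_abs_le (Real.log a), le_abs_self (Real.log b),
    abs_nonneg (Real.log a), abs_nonneg (Real.log b)]

/-- The entropy of a probability vector whose positive entries all lie in
`[a / N, b / N]` differs from `log N` by a bounded amount. -/
theorem abs_entropy_sub_log_le {ι : Type*} [Fintype ι] {p : ι → ℝ} {N a b : ℝ} (hN : 0 < N)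
    (ha : 0 < a) (h0 : ∀ i, 0 ≤ p i) (hsum : ∑ i, p i = 1)
    (hp : ∀ i, 0 < p i → a ≤ N * p i ∧ N * p i ≤ b) :
    |(-∑ i, p i * Real.log (p i)) - Real.log N| ≤ |Real.log a| + |Real.log b| := by
  have key : (-∑ i, p i * Real.log (p i)) - Real.log N = -∑ i, p i * Real.log (N * p i) := by
    have : ∀ i, p i * Real.log (N * p i) = p i * Real.log N + p i * Real.log (p i) := by
      intro i
      rcases (h0 i).eq_or_lt with h | h
      · simp [← h]
      · rw [Real.log_mul hN.ne' h.ne']; ring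
    simp_rw [this]
    rw [Finset.sum_add_distrib, ← Finset.sum_mul, hsum]; ring
  rw [key, abs_neg]
  calc |∑ i, p i * Real.log (N * p i)| ≤ ∑ i, |p i * Real.log (N * p i)| :=
        Finset.abs_sum_le_sum_abs _ _
    _ ≤ ∑ i, p i * (|Real.log a| + |Real.log b|) := by
        refine Finset.sum_le_sum fun i _ => ?_
        rw [abs_mul, abs_of_nonneg (h0 i)]
        rcases (h0 i).eq_or_lt with h | h
        · simp [← h]
        · exact mul_le_mul_of_nonneg_left (abs_log_le_of_mem ha (hp i h).1 (hp i h).2) h.le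
    _ = _ := by rw [← Finset.sum_mul, hsum, one_mul]

theorem Matrix.IsHermitian.diag_le_of_eigenvalues_le {ι : Type*} [Fintype ι] [DecidableEq ι]
    {A : Matrix ι ι ℝ} (hA : A.IsHermitian) {M : ℝ} (hM : ∀ i, hA.eigenvalues i ≤ M) (i : ι) :
    A i i ≤ M := by
  have hU : ∑ k, (hA.eigenvectorUnitary : Matrix ι ι ℝ) i k ^ 2 = 1 := by
    have h := congrFun (congrFun (Unitary.coe_mul_star_self hA.eigenvectorUnitary) i) i
    simpa [Matrix.mul_apply, Matrix.star_apply, pow_two] using h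
  have hAi : A i i = ∑ k, hA.eigenvalues k * (hA.eigenvectorUnitary : Matrix ι ι ℝ) i k ^ 2 := by
    have h := congrFun (congrFun hA.spectral_theorem i) i
    rw [Unitary.conjStarAlgAut_apply, Matrix.mul_apply] at h
    rw [h]
    refine Finset.sum_congr rfl fun k _ => ?_
    simp [Matrix.mul_diagonal, Matrix.star_apply]
    ring
  calc A i i ≤ ∑ k, M * (hA.eigenvectorUnitary : Matrix ι ι ℝ) i k ^ 2 := by
        rw [hAi]
        exact Finset.sum_le_sum fun k _ => mul_le_mul_of_nonneg_right (hM k) (sq_nonneg _)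
    _ = M := by rw [← Finset.mul_sum, hU, mul_one]

theorem Matrix.IsHermitian.eigenvalues_nonneg_of_sum_abs_le_diag {ι : Type*} [Fintype ι]
    [DecidableEq ι] {A : Matrix ι ι ℝ} (hA : A.IsHermitian)
    (h : ∀ i, ∑ j ∈ Finset.univ.erase i, |A i j| ≤ A i i) (i : ι) : 0 ≤ hA.eigenvalues i := by
  have hev : Module.End.HasEigenvalue (Matrix.toLin' A) (hA.eigenvalues i) := by
    rw [Module.End.hasEigenvalue_iff_mem_spectrum, Matrix.spectrum_toLin']
    exact hA.eigenvalues_mem_spectrum_real i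
  obtain ⟨k, hk⟩ := eigenvalue_mem_ball hev
  rw [Metric.mem_closedBall, Real.dist_eq, abs_le] at hk
  simp only [Real.norm_eq_abs] at hk
  linarith [h k, hk.1]

/-- If at least `α * N` of the `N` entries of a probability vector are positive, all entries are at
most `M` and the positive ones at least `β * M`, then `N * M` lies in `[1, (α * β)⁻¹]`. -/
theorem one_le_card_mul_and_card_mul_le {ι : Type*} [Fintype ι] {p : ι → ℝ} {M α β : ℝ}
    (hα : 0 < α) (hβ : 0 < β) (h0 : ∀ i, 0 ≤ p i) (hsum : ∑ i, p i = 1)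
    (hle : ∀ i, p i ≤ M) (hge : ∀ i, 0 < p i → β * M ≤ p i)
    (hcard : α * Fintype.card ι ≤ (Nat.card {i : ι // 0 < p i} : ℝ)) :
    1 ≤ Fintype.card ι * M ∧ Fintype.card ι * M ≤ (α * β)⁻¹ := by
  classical
  have h1 : 1 ≤ Fintype.card ι * M := by
    rw [← hsum]
    simpa using Finset.sum_le_sum fun i (_ : i ∈ Finset.univ) => hle i
  have hM : 0 ≤ M := by
    by_contra! hM
    have : (0 : ℝ) ≤ Fintype.card ι := Nat.cast_nonneg _
    nlinarith
  refine ⟨h1, ?_⟩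
  have h2 : (Nat.card {i : ι // 0 < p i} : ℝ) * (β * M) ≤ 1 := by
    calc (Nat.card {i : ι // 0 < p i} : ℝ) * (β * M)
        = ∑ i ∈ Finset.univ.filter (fun i => 0 < p i), β * M := by
          rw [Finset.sum_const, nsmul_eq_mul, Nat.card_eq_fintype_card, Fintype.card_subtype]
      _ ≤ ∑ i ∈ Finset.univ.filter (fun i => 0 < p i), p i :=
          Finset.sum_le_sum fun i hi => hge i (Finset.mem_filter.mp hi).2
      _ ≤ ∑ i, p i :=
          Finset.sum_le_sum_of_subset_of_nonneg (Finset.filter_subset _ _) fun i _ _ => h0 i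
      _ = 1 := hsum
  rw [← one_div, le_div_iff₀ (mul_pos hα hβ)]
  calc Fintype.card ι * M * (α * β) = α * Fintype.card ι * (β * M) := by ring
    _ ≤ _ := mul_le_mul_of_nonneg_right hcard (mul_nonneg hβ.le hM)
    _ ≤ 1 := h2

/-- For a probability vector with a linear number of positive entries of comparable size, the entropy
differs from its quadratic approximation `-(1 - ∑ i, p i ^ 2) * log (2 * y)`, where `y` is at least
the average entry and at most the upper bound `M`, by a constant independent of the dimension. -/
theorem abs_entropy_sub_approx_le {ι : Type*} [Fintype ι] {p : ι → ℝ} {M α β y : ℝ}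
    (hα : 0 < α) (hβ : 0 < β) (h0 : ∀ i, 0 ≤ p i) (hsum : ∑ i, p i = 1)
    (hle : ∀ i, p i ≤ M) (hge : ∀ i, 0 < p i → β * M ≤ p i)
    (hcard : α * Fintype.card ι ≤ (Nat.card {i : ι // 0 < p i} : ℝ))
    (hy : 1 ≤ Fintype.card ι * y) (hyM : y ≤ M) :
    |(-∑ i, p i * Real.log (p i)) - -(1 - ∑ i, p i ^ 2) * Real.log (2 * y)| ≤
      |Real.log β| + |Real.log (α * β)⁻¹| + (α * β)⁻¹ +
        (|Real.log 2| + |Real.log (2 * (α * β)⁻¹)|) := by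
  obtain ⟨h1, h2⟩ := one_le_card_mul_and_card_mul_le hα hβ h0 hsum hle hge hcard
  set N : ℝ := ((Fintype.card ι : ℕ) : ℝ)
  set b := (α * β)⁻¹
  have hN : 0 < N := by
    refine lt_of_le_of_ne (Nat.cast_nonneg _) fun h => ?_
    rw [← h] at h1
    linarith
  have hN1 : 1 ≤ N := by
    have : 0 < Fintype.card ι := Nat.cast_pos.mp hN
    exact Nat.one_le_cast.mpr this
  have hypos : 0 < y := pos_of_mul_pos_right (by linarith) hN.le
  have hent := abs_entropy_sub_log_le (b := b) hN hβ h0 hsum fun i hi => by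
    have := mul_le_mul_of_nonneg_left (hge i hi) hN.le
    have := mul_le_mul_of_nonneg_left (hle i) hN.le
    constructor <;> nlinarith
  have hNy := mul_le_mul_of_nonneg_left hyM hN.le
  have hlog : |Real.log (N * (2 * y))| ≤ |Real.log 2| + |Real.log (2 * b)| :=
    abs_log_le_of_mem two_pos (by linarith) (by linarith)
  have hsq0 : 0 ≤ ∑ i, p i ^ 2 := Finset.sum_nonneg fun i _ => sq_nonneg _
  have hsqM : ∑ i, p i ^ 2 ≤ M := by
    calc ∑ i, p i ^ 2 ≤ ∑ i, p i * M := Finset.sum_le_sum fun i _ => by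
          rw [pow_two]; exact mul_le_mul_of_nonneg_left (hle i) (h0 i)
      _ = M := by rw [← Finset.sum_mul, hsum, one_mul]
  have hsq1 : ∑ i, p i ^ 2 ≤ 1 := by
    rw [← hsum]
    refine Finset.sum_le_sum fun i hi => ?_
    have : p i ≤ 1 := hsum ▸ Finset.single_le_sum (fun j _ => h0 j) hi
    nlinarith [h0 i]
  have hNlog : |Real.log N * ∑ i, p i ^ 2| ≤ b := by
    rw [abs_of_nonneg (mul_nonneg (Real.log_nonneg hN1) hsq0)]
    calc _ ≤ N * M := mul_le_mul (Real.log_le_self hN.le) hsqM hsq0 hN.le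
      _ ≤ b := h2
  have hQ : |(1 - ∑ i, p i ^ 2) * Real.log (N * (2 * y))| ≤
      |Real.log 2| + |Real.log (2 * b)| := by
    rw [abs_mul, abs_of_nonneg (by linarith)]
    nlinarith [abs_nonneg (Real.log (N * (2 * y)))]
  rw [Real.log_mul hN.ne' (by positivity)] at hQ
  calc _ = |((-∑ i, p i * Real.log (p i)) - Real.log N) + Real.log N * ∑ i, p i ^ 2 +
        (1 - ∑ i, p i ^ 2) * (Real.log N + Real.log (2 * y))| := by congr 1; ring
    _ ≤ _ := (abs_add_three _ _ _).trans (add_le_add (add_le_add hent hNlog) hQ)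

theorem trace_diagonal_sum_sub {ι : Type*} [Fintype ι] [DecidableEq ι] {A : Matrix ι ι ℝ}
    (hA : ∀ i, A i i = 0) :
    (Matrix.diagonal (fun i => ∑ j, A i j) - A).trace = ∑ i, ∑ j, A i j := by
  simp [Matrix.trace, hA]

/-- **Corollary 3 (o(ln n) approximation error of H̃).**
For each `n`, let `W n` be the (symmetric, nonnegative, zero-diagonal, nonzero)
weight matrix of a graph on `n` vertices, with trace-normalized Laplacian `LN n`,
von Neumann graph entropy `H n`, quadratic approximation `Q n`, largest eigenvalue
`lmax n`, smallest strictly positive eigenvalue `lmin n`, `n_+` strictly positive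
eigenvalues, nodal strengths `s n i`, maximal nodal strength `smax n`, total
strength `S n > 0`, `c n = 1 / S n`, and incremental FINGER approximation
`H̃ n = -(Q n) * ln (2 * c n * smax n)`. If there exist constants `α, β > 0` such
that for all sufficiently large `n`, `n_+ ≥ α·n`, `lmax n < 1` and
`lmin n ≥ β·lmax n`, then the scaled approximation error
`(H n - H̃ n) / ln n → 0` as `n → ∞`. -/
theorem finger_hTilde_approximation_error
    (W : ∀ n : ℕ, Matrix (Fin n) (Fin n) ℝ)
    (hsymm : ∀ n, 2 ≤ n → (W n).IsSymm)
    (hnonneg : ∀ n, 2 ≤ n → ∀ i j, 0 ≤ W n i j)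
    (hdiag : ∀ n, 2 ≤ n → ∀ i, W n i i = 0)
    (hW : ∀ n, 2 ≤ n → W n ≠ 0)
    (s : ∀ n : ℕ, Fin n → ℝ) (hs : ∀ n i, s n i = ∑ j, W n i j)
    (smax : ℕ → ℝ) (hsmax : ∀ n, 2 ≤ n → IsGreatest {x | ∃ i, s n i = x} (smax n))
    (S : ℕ → ℝ) (hS : ∀ n, S n = ∑ i, s n i) (hSpos : ∀ n, 2 ≤ n → 0 < S n)
    (c : ℕ → ℝ) (hc : ∀ n, c n = 1 / S n)
    (LN : ∀ n : ℕ, Matrix (Fin n) (Fin n) ℝ)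
    (hLN : ∀ n, LN n = (Matrix.diagonal (fun i => ∑ j, W n i j) - W n).trace⁻¹ •
        (Matrix.diagonal (fun i => ∑ j, W n i j) - W n))
    (hH : ∀ n, (LN n).IsHermitian)
    (lmax lmin : ℕ → ℝ)
    (hlmax : ∀ n, 2 ≤ n → IsGreatest {x | ∃ i, (hH n).eigenvalues i = x} (lmax n))
    (hlmin : ∀ n, 2 ≤ n → IsLeast {x | 0 < x ∧ ∃ i, (hH n).eigenvalues i = x} (lmin n))
    (H Q : ℕ → ℝ)
    (hHdef : ∀ n, H n = -∑ i, (hH n).eigenvalues i * Real.log ((hH n).eigenvalues i))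
    (hQdef : ∀ n, Q n = 1 - ∑ i, ((hH n).eigenvalues i) ^ 2)
    (Htilde : ℕ → ℝ)
    (hHtilde : ∀ n, Htilde n = -(Q n) * Real.log (2 * c n * smax n))
    (α β : ℝ) (hα : 0 < α) (hβ : 0 < β)
    (hbig : ∀ᶠ n in Filter.atTop,
      α * n ≤ (Nat.card {i : Fin n // 0 < (hH n).eigenvalues i} : ℝ)
      ∧ lmax n < 1 ∧ β * lmax n ≤ lmin n) :
    Filter.Tendsto (fun n => (H n - Htilde n) / Real.log n) Filter.atTop (nhds 0) := by
  set K : ℝ := |Real.log β| + |Real.log (α * β)⁻¹| + (α * β)⁻¹ +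
    (|Real.log 2| + |Real.log (2 * (α * β)⁻¹)|)
  have hbound : ∀ᶠ n : ℕ in Filter.atTop, |H n - Htilde n| ≤ K := by
    filter_upwards [hbig, Filter.eventually_ge_atTop 2] with n ⟨hcard, _, hgap⟩ hn
    have htr : (Matrix.diagonal (fun i => ∑ j, W n i j) - W n).trace = S n := by
      rw [trace_diagonal_sum_sub (hdiag n hn), hS]
      simp_rw [hs]
    have hLNn := hLN n
    rw [htr] at hLNn
    have hdiagLN : ∀ i, LN n i i = c n * s n i := fun i => by
      simp [hLNn, hc, hs, hdiag n hn]
    have h0 : ∀ i, 0 ≤ (hH n).eigenvalues i := by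
      refine (hH n).eigenvalues_nonneg_of_sum_abs_le_diag fun i => ?_
      rw [hdiagLN, hc, hs, one_div, Finset.mul_sum,
        ← Finset.sum_erase Finset.univ (a := i) (by simp [hdiag n hn])]
      refine Finset.sum_le_sum fun j hj => ?_
      have hij : i ≠ j := (Finset.ne_of_mem_erase hj).symm
      simp [hLNn, Matrix.diagonal_apply_ne _ hij, abs_mul, abs_of_pos (hSpos n hn),
        abs_of_nonneg (hnonneg n hn i j)]
    have hsum : ∑ i, (hH n).eigenvalues i = 1 := by
      have htrLN : (LN n).trace = 1 := by
        rw [hLNn, Matrix.trace_smul, htr, smul_eq_mul, inv_mul_cancel₀ (hSpos n hn).ne']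
      simpa [htrLN] using (hH n).trace_eq_sum_eigenvalues.symm
    have hle : ∀ i, (hH n).eigenvalues i ≤ lmax n := fun i => (hlmax n hn).2 ⟨i, rfl⟩
    have hge : ∀ i, 0 < (hH n).eigenvalues i → β * lmax n ≤ (hH n).eigenvalues i :=
      fun i hi => hgap.trans ((hlmin n hn).2 ⟨hi, i, rfl⟩)
    have hy : 1 ≤ Fintype.card (Fin n) * (c n * smax n) := by
      have h : S n ≤ n * smax n := by
        rw [hS]
        simpa using Finset.sum_le_sum fun i (_ : i ∈ Finset.univ) => (hsmax n hn).2 ⟨i, rfl⟩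
      rw [Fintype.card_fin, hc, mul_left_comm, one_div, ← div_eq_inv_mul,
        one_le_div (hSpos n hn)]
      exact h
    have hyM : c n * smax n ≤ lmax n := by
      obtain ⟨i, hi⟩ := (hsmax n hn).1
      rw [← hi, ← hdiagLN]
      exact (hH n).diag_le_of_eigenvalues_le hle i
    have := abs_entropy_sub_approx_le hα hβ h0 hsum hle hge (by simpa using hcard) hy hyM
    rwa [hHdef, hHtilde, hQdef, mul_assoc]
  have hlog : Filter.Tendsto (fun n : ℕ => Real.log n) Filter.atTop Filter.atTop :=
    Real.tendsto_log_atTop.comp tendsto_natCast_atTop_atTop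
  refine squeeze_zero_norm' ?_ (hlog.const_div_atTop K)
  filter_upwards [hbound] with n hn
  rw [Real.norm_eq_abs, abs_div, abs_of_nonneg (Real.log_natCast_nonneg n)]
  exact div_le_div_of_nonneg_right hn (Real.log_natCast_nonneg n)
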